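/- arXiv:cs/9809012 — 2 statements merged into one kernel-verified Lean document; each statement's English description precedes it below -/
import Mathlib

section
/- Let G be a multigraph on n ≥ 2 vertices with minimum cut value c ≥ 1, and suppose each edge fails independently with probability p ∈ [0,1], where p^c = n^{-(2+δ)} for some real δ > 0. Then the probability that the surviving graph is disconnected is at most n^{-δ}(1 + 2/δ). -/
open scoped Classical

/-- A multigraph on vertex type `V` is given by an edge-index type `E` together with a map
`ends : E → Sym2 V` assigning to each edge its (unordered) pair of endpoints; the hypothesis
`∀ e, ¬ (ends e).IsDiag` says that the two endpoints of every edge are distinct.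
`survGraph ends F` is the simple graph on `V` whose adjacencies are given by the edges of the
multigraph that survive when the edges in `F` fail. -/
def survGraph {V E : Type} (ends : E → Sym2 V) (F : Finset E) : SimpleGraph V :=
  SimpleGraph.fromRel (fun x y => ∃ e, e ∉ F ∧ ends e = s(x, y))

/-- The number of connected components of the graph surviving after the edges in `F` fail. -/
noncomputable def numComponents {V E : Type} (ends : E → Sym2 V) (F : Finset E) : ℕ :=
  Nat.card (survGraph ends F).ConnectedComponent

/-- Edge `e` crosses the 2-way cut determined by the vertex set `A` (one endpoint in `A`,
one endpoint outside `A`). -/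
def crosses {V E : Type} (ends : E → Sym2 V) (A : Finset V) (e : E) : Prop :=
  (∃ x ∈ ends e, x ∈ A) ∧ (∃ x ∈ ends e, x ∉ A)

/-- The edge set of the 2-way cut determined by the vertex set `A`. -/
noncomputable def cutEdges {V E : Type} [Fintype E] (ends : E → Sym2 V) (A : Finset V) :
    Finset E :=
  Finset.univ.filter (crosses ends A)

/-- The value of the 2-way cut determined by the vertex set `A`. -/
noncomputable def cutValue {V E : Type} [Fintype E] (ends : E → Sym2 V) (A : Finset V) : ℕ :=
  (cutEdges ends A).card

/-- When each edge fails independently with probability `p`, this is the probability that the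
(random) set of failed edges is a member of `S`. -/
noncomputable def failurePr {E : Type} [Fintype E] (p : ℝ) (S : Finset (Finset E)) : ℝ :=
  ∑ F ∈ S, p ^ F.card * (1 - p) ^ (Fintype.card E - F.card)

/-- The vertex sets that determine a cut: those that are neither empty nor everything. -/
noncomputable def properSets (V : Type) [Fintype V] : Finset (Finset V) :=
  Finset.univ.filter (fun A => A.Nonempty ∧ ∃ v, v ∉ A)

/-- The vertex sets that determine a cut of value at most `s`. -/
noncomputable def smallCuts {V E : Type} [Fintype V] [Fintype E] (ends : E → Sym2 V) (s : ℝ) :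
    Finset (Finset V) :=
  (properSets V).filter (fun A => (cutValue ends A : ℝ) ≤ s)

lemma mem_properSets {V : Type} [Fintype V] {A : Finset V} :
    A ∈ properSets V ↔ A.Nonempty ∧ ∃ v, v ∉ A := by
  simp [properSets]

lemma mem_smallCuts {V E : Type} [Fintype V] [Fintype E] {ends : E → Sym2 V} {s : ℝ}
    {A : Finset V} :
    A ∈ smallCuts ends s ↔ A ∈ properSets V ∧ (cutValue ends A : ℝ) ≤ s := by
  simp [smallCuts]

lemma crosses_iff_of_ends_eq {V E : Type} {ends : E → Sym2 V} {A : Finset V} {e : E} {a b : V}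
    (h : ends e = s(a, b)) : crosses ends A e ↔ ¬ (a ∈ A ↔ b ∈ A) := by
  unfold crosses
  rw [h]
  simp only [Sym2.mem_iff, exists_eq_or_imp, exists_eq_left]
  tauto

lemma not_isDiag_of_crosses {V E : Type} {ends : E → Sym2 V} {A : Finset V} {e : E}
    (h : crosses ends A e) : ¬ (ends e).IsDiag := by
  obtain ⟨a, b, hab⟩ : ∃ a b, ends e = s(a, b) := by
    induction h' : ends e with | _ a b => exact ⟨a, b, rfl⟩
  rw [crosses_iff_of_ends_eq hab] at h
  rw [hab, Sym2.mk_isDiag_iff]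
  rintro rfl
  exact h Iff.rfl

lemma cutValue_map {V W E : Type} [Fintype V] [Fintype E] (ends : E → Sym2 V) (q : V → W)
    (B : Finset W) :
    cutValue (fun e => (ends e).map q) B
      = cutValue ends (Finset.univ.filter (fun v => q v ∈ B)) := by
  unfold cutValue cutEdges
  congr 1
  ext e
  simp [crosses, Sym2.mem_map]

lemma card_filter_crosses_singleton_le {V E : Type} [Fintype V] (ends : E → Sym2 V) (e : E) :
    (Finset.univ.filter (fun v => crosses ends {v} e)).card
      ≤ if (ends e).IsDiag then 0 else 2 := by
  split_ifs with h
  · rw [Nat.le_zero, Finset.card_eq_zero, Finset.filter_eq_empty_iff]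
    exact fun v _ hv => not_isDiag_of_crosses hv h
  · obtain ⟨a, b, hab⟩ : ∃ a b, ends e = s(a, b) := by
      induction h' : ends e with | _ a b => exact ⟨a, b, rfl⟩
    refine (Finset.card_le_card (t := {a, b}) ?_).trans Finset.card_le_two
    intro v hv
    rw [Finset.mem_filter, crosses_iff_of_ends_eq hab] at hv
    simp only [Finset.mem_singleton] at hv
    simp only [Finset.mem_insert, Finset.mem_singleton]
    grind

lemma card_mul_le_two_mul_card_edges {V E : Type} [Fintype V] [Fintype E] (ends : E → Sym2 V)
    (hV : 2 ≤ Fintype.card V) (c : ℕ) (hmin : ∀ A ∈ properSets V, c ≤ cutValue ends A) :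
    Fintype.card V * c ≤ 2 * (Finset.univ.filter (fun e => ¬ (ends e).IsDiag)).card := by
  have hnt : Nontrivial V := Fintype.one_lt_card_iff_nontrivial.mp hV
  calc Fintype.card V * c = ∑ _v : V, c := by simp
    _ ≤ ∑ v : V, cutValue ends {v} := by
        refine Finset.sum_le_sum fun v _ => hmin _ (mem_properSets.mpr ⟨⟨v, by simp⟩, ?_⟩)
        obtain ⟨w, hw⟩ := exists_ne v
        exact ⟨w, by simpa using hw⟩
    _ = ∑ e : E, (Finset.univ.filter (fun v => crosses ends {v} e)).card := by
        simp only [cutValue, cutEdges, Finset.card_filter]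
        exact Finset.sum_comm
    _ ≤ ∑ e : E, if (ends e).IsDiag then 0 else 2 :=
        Finset.sum_le_sum fun e _ => card_filter_crosses_singleton_le ends e
    _ = 2 * (Finset.univ.filter (fun e => ¬ (ends e).IsDiag)).card := by
        rw [Finset.sum_ite]
        simp [mul_comm]

/-- Contracting an edge: small cuts avoiding a given edge are cuts of a graph with one vertex
fewer. -/
lemma exists_contraction {V E : Type} [Fintype V] [Fintype E] (ends : E → Sym2 V) (c : ℕ)
    (hmin : ∀ A ∈ properSets V, c ≤ cutValue ends A) (s : ℝ) (e : E)
    (he : ¬ (ends e).IsDiag) :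
    ∃ (W : Type) (_ : Fintype W) (ends' : E → Sym2 W), Fintype.card W + 1 = Fintype.card V ∧
      (∀ B ∈ properSets W, c ≤ cutValue ends' B) ∧
      ((smallCuts ends s).filter (fun A => ¬ crosses ends A e)).card
        ≤ (smallCuts ends' s).card := by
  obtain ⟨x, y, hxy⟩ : ∃ a b, ends e = s(a, b) := by
    induction h' : ends e with | _ a b => exact ⟨a, b, rfl⟩
  have hne : x ≠ y := by
    rwa [hxy, Sym2.mk_isDiag_iff] at he
  let q : V → {v // v ≠ y} := fun v => if h : v = y then ⟨x, hne⟩ else ⟨v, h⟩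
  have hq : ∀ w : {v // v ≠ y}, q w.1 = w := fun w => by simp [q, w.2]
  let pre : Finset {v // v ≠ y} → Finset V := fun B => Finset.univ.filter (fun v => q v ∈ B)
  refine ⟨{v // v ≠ y}, inferInstance, fun e => (ends e).map q, ?_, ?_, ?_⟩
  · have h1 : 0 < Fintype.card V := Fintype.card_pos_iff.mpr ⟨x⟩
    simp only [ne_eq, Fintype.card_subtype_compl, Fintype.card_unique]
    omega
  · intro B hB
    rw [cutValue_map]
    obtain ⟨⟨w, hw⟩, z, hz⟩ := mem_properSets.mp hB
    exact hmin _ (mem_properSets.mpr ⟨⟨w, by simpa [hq] using hw⟩, z, by simpa [hq] using hz⟩)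
  · refine (Finset.card_le_card (t := (smallCuts _ s).image pre) ?_).trans Finset.card_image_le
    intro A hA
    rw [Finset.mem_filter, mem_smallCuts, crosses_iff_of_ends_eq hxy, not_not] at hA
    obtain ⟨⟨hA, hs⟩, hiff⟩ := hA
    have hqA : ∀ v, (q v).1 ∈ A ↔ v ∈ A := by
      intro v
      by_cases h : v = y
      · subst h
        simpa [q] using hiff
      · simp [q, h]
    have hpre : pre (Finset.univ.filter (fun w => w.1 ∈ A)) = A := by
      ext v
      simp only [pre, Finset.mem_filter, Finset.mem_univ, true_and, hqA]
    refine Finset.mem_image.mpr ⟨Finset.univ.filter (fun w => w.1 ∈ A), ?_, hpre⟩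
    rw [← hpre] at hs
    rw [mem_smallCuts, cutValue_map]
    refine ⟨?_, le_of_eq_of_le (by congr!) hs⟩
    obtain ⟨⟨w, hw⟩, z, hz⟩ := mem_properSets.mp hA
    exact mem_properSets.mpr ⟨⟨q w, by simpa [hqA] using hw⟩, q z, by simpa [hqA] using hz⟩

/-- Averaging over the contracted edge. -/
lemma card_smallCuts_mul_le {V E : Type} [Fintype V] [Fintype E] (ends : E → Sym2 V) (s K : ℝ)
    (hK : ∀ e, ¬ (ends e).IsDiag →
      (((smallCuts ends s).filter (fun A => ¬ crosses ends A e)).card : ℝ) ≤ K) :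
    ((smallCuts ends s).card : ℝ)
        * ((Finset.univ.filter (fun e => ¬ (ends e).IsDiag)).card - s)
      ≤ (Finset.univ.filter (fun e => ¬ (ends e).IsDiag)).card * K := by
  set N := Finset.univ.filter (fun e => ¬ (ends e).IsDiag) with hN
  have hsub : ∀ A, cutEdges ends A ⊆ N := fun A e he => by
    simp only [cutEdges, Finset.mem_filter, Finset.mem_univ, true_and] at he
    simpa [hN] using not_isDiag_of_crosses he
  calc ((smallCuts ends s).card : ℝ) * (N.card - s)
      = ∑ _A ∈ smallCuts ends s, ((N.card : ℝ) - s) := by rw [Finset.sum_const, nsmul_eq_mul]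
    _ ≤ ∑ A ∈ smallCuts ends s, ((N.filter (fun e => ¬ crosses ends A e)).card : ℝ) := by
        refine Finset.sum_le_sum fun A hA => ?_
        have h1 : N.filter (fun e => ¬ crosses ends A e) = N \ cutEdges ends A := by
          ext e
          simp [cutEdges]
        rw [h1, Finset.cast_card_sdiff (hsub A)]
        have := (mem_smallCuts.mp hA).2
        unfold cutValue at this
        linarith
    _ = ∑ e ∈ N, (((smallCuts ends s).filter (fun A => ¬ crosses ends A e)).card : ℝ) := by
        simp only [Finset.card_filter, Nat.cast_sum]
        exact Finset.sum_comm
    _ ≤ ∑ _e ∈ N, K := Finset.sum_le_sum fun e he => hK e (by simpa [hN] using he)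
    _ = N.card * K := by simp

lemma card_smallCuts_le_two_pow {V E : Type} [Fintype V] [Fintype E] (ends : E → Sym2 V)
    (s : ℝ) : (smallCuts ends s).card ≤ 2 ^ Fintype.card V := by
  refine (Finset.card_le_univ _).trans ?_
  simp

lemma Real.Gamma_le_one_of_mem_Icc {x : ℝ} (hx : x ∈ Set.Icc (1 : ℝ) 2) : Real.Gamma x ≤ 1 := by
  have h := Real.convexOn_Gamma.le_max_of_mem_Icc (x := 1) (y := 2) (z := x)
    (by simp) (by simp) hx
  simpa using h

lemma two_pow_le_two_mul_factorial (u : ℕ) : 2 ^ u ≤ 2 * u.factorial := by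
  induction u with
  | zero => simp
  | succ u ih =>
    rcases Nat.eq_zero_or_pos u with rfl | hu
    · simp
    · rw [pow_succ, Nat.factorial_succ]
      nlinarith

lemma card_smallCuts_le_Gamma {E : Type} [Fintype E] (c : ℕ) (hc : 1 ≤ c) (k : ℝ) (hk : 2 ≤ k)
    (u : ℕ) :
    ∀ (V : Type) [Fintype V] (ends : E → Sym2 V), Fintype.card V = u → k ≤ u →
      (∀ A ∈ properSets V, c ≤ cutValue ends A) →
      ((smallCuts ends (k * c / 2)).card : ℝ)
        ≤ 2 * (Real.Gamma (u + 1) / Real.Gamma (u + 1 - k)) := by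
  induction u with
  | zero =>
    intro V _ ends _ hku
    norm_num at hku
    linarith
  | succ u ih =>
    intro V _ ends hV hku hmin
    rcases lt_or_ge (u : ℝ) k with hlt | hge
    · push_cast at hku ⊢
      have hG := Real.Gamma_le_one_of_mem_Icc (x := (u : ℝ) + 1 + 1 - k)
        ⟨by linarith, by linarith⟩
      have hG0 : 0 < Real.Gamma ((u : ℝ) + 1 + 1 - k) := Real.Gamma_pos_of_pos (by linarith)
      have h1 : Real.Gamma ((u : ℝ) + 1 + 1) = ((u + 1).factorial : ℝ) := by
        exact_mod_cast Real.Gamma_nat_eq_factorial (u + 1)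
      have h2 : ((smallCuts ends (k * c / 2)).card : ℝ) ≤ 2 * ((u + 1).factorial : ℝ) := by
        have h3 := card_smallCuts_le_two_pow ends (k * c / 2)
        rw [hV] at h3
        exact_mod_cast h3.trans (two_pow_le_two_mul_factorial (u + 1))
      refine h2.trans ?_
      rw [h1]
      gcongr
      exact le_div_self (by positivity) hG0 hG
    · have hu2 : (2 : ℝ) ≤ u := hk.trans hge
      set K : ℝ := 2 * (Real.Gamma (u + 1) / Real.Gamma (u + 1 - k)) with hKdef
      have hG0 : 0 < Real.Gamma ((u : ℝ) + 1 - k) := Real.Gamma_pos_of_pos (by linarith)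
      have hK0 : 0 ≤ K := by
        have : 0 < Real.Gamma ((u : ℝ) + 1) := Real.Gamma_pos_of_pos (by linarith)
        positivity
      have havg := card_smallCuts_mul_le ends (k * c / 2) K (by
        intro e he
        obtain ⟨W, _, ends', hW, hmin', hle⟩ :=
          exists_contraction ends c hmin (k * c / 2) e he
        have := ih W ends' (by omega) hge hmin'
        exact le_trans (by exact_mod_cast hle) this)
      have hV2 : 2 ≤ Fintype.card V := by
        have : 2 ≤ u := by exact_mod_cast hu2
        omega
      have hedge := card_mul_le_two_mul_card_edges ends hV2 c hmin
      set m := (Finset.univ.filter (fun e => ¬ (ends e).IsDiag)).card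
      set N : ℝ := ((smallCuts ends (k * c / 2)).card : ℝ)
      have hN0 : 0 ≤ N := by positivity
      have hedge' : ((u : ℝ) + 1) * c ≤ 2 * m := by
        rw [hV] at hedge
        exact_mod_cast hedge
      have hc' : (1 : ℝ) ≤ c := by exact_mod_cast hc
      have hm : (0 : ℝ) < m := by nlinarith
      have hrec : 2 * (Real.Gamma (((u + 1 : ℕ) : ℝ) + 1)
          / Real.Gamma (((u + 1 : ℕ) : ℝ) + 1 - k)) = (u + 1) / (u + 1 - k) * K := by
        push_cast
        rw [hKdef, Real.Gamma_add_one (s := (u : ℝ) + 1) (by linarith),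
          show (u : ℝ) + 1 + 1 - k = (u + 1 - k) + 1 by ring,
          Real.Gamma_add_one (s := (u : ℝ) + 1 - k) (by linarith)]
        have : (u : ℝ) + 1 - k ≠ 0 := by linarith
        field_simp
      rw [hrec, div_mul_eq_mul_div, le_div_iff₀ (by linarith)]
      have h1 : N * ((m : ℝ) * (u + 1 - k)) ≤ (u + 1) * (N * (m - k * c / 2)) := by
        have : (m : ℝ) * (u + 1 - k) ≤ (u + 1) * (m - k * c / 2) := by nlinarith
        nlinarith [mul_le_mul_of_nonneg_left this hN0]
      have h2 : (u + 1) * (N * (m - k * c / 2)) ≤ (u + 1) * (m * K) :=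
        mul_le_mul_of_nonneg_left havg (by positivity)
      refine le_of_mul_le_mul_left ?_ hm
      linarith

lemma Real.Gamma_div_Gamma_le_rpow {x k : ℝ} (hk : 1 ≤ k) (hx : 0 < x) (hxk : 0 < x + 1 - k) :
    Real.Gamma (x + 1) / Real.Gamma (x + 1 - k) ≤ x ^ k := by
  have h1 : 0 < Real.Gamma (x + 1) := Real.Gamma_pos_of_pos (by linarith)
  have h2 : 0 < Real.Gamma (x + 1 - k) := Real.Gamma_pos_of_pos hxk
  have h3 : 0 < Real.Gamma x := Real.Gamma_pos_of_pos hx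
  rw [← Real.log_le_log_iff (by positivity) (by positivity), Real.log_div h1.ne' h2.ne',
    Real.log_rpow hx]
  have hrec : Real.log (Real.Gamma (x + 1)) = Real.log x + Real.log (Real.Gamma x) := by
    rw [Real.Gamma_add_one hx.ne', Real.log_mul hx.ne' h3.ne']
  have hconv := Real.convexOn_log_Gamma.2 (show x + 1 - k ∈ Set.Ioi 0 from hxk)
    (show x + 1 ∈ Set.Ioi 0 from Set.mem_Ioi.mpr (by linarith))
    (show 0 ≤ 1 / k by positivity) (show 0 ≤ 1 - 1 / k by rw [sub_nonneg, div_le_one (by linarith)]; exact hk)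
    (by ring)
  have hk0 : k ≠ 0 := by linarith
  have hpt : (1 / k) • (x + 1 - k) + (1 - 1 / k) • (x + 1) = x := by
    simp only [smul_eq_mul]
    field_simp
    ring
  rw [hpt] at hconv
  simp only [Function.comp, smul_eq_mul] at hconv
  have := mul_le_mul_of_nonneg_left hconv (by linarith : 0 ≤ k)
  have h4 : k * (1 / k * Real.log (Real.Gamma (x + 1 - k))
      + (1 - 1 / k) * Real.log (Real.Gamma (x + 1)))
      = Real.log (Real.Gamma (x + 1 - k)) + (k - 1) * Real.log (Real.Gamma (x + 1)) := by
    field_simp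
  rw [h4] at this
  nlinarith

/-- Karger's bound on the number of near-minimum cuts. Each cut is counted twice, once for each
of its sides. -/
lemma card_smallCuts_le {V E : Type} [Fintype V] [Fintype E] (ends : E → Sym2 V)
    (hn : 2 ≤ Fintype.card V) (c : ℕ) (hc : 1 ≤ c)
    (hmin : ∀ A ∈ properSets V, c ≤ cutValue ends A) (k : ℝ) (hk : 2 ≤ k) :
    ((smallCuts ends (k * c / 2)).card : ℝ) ≤ 2 * (Fintype.card V : ℝ) ^ k := by
  have hn' : (2 : ℝ) ≤ Fintype.card V := by exact_mod_cast hn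
  rcases le_or_gt k (Fintype.card V) with hle | hlt
  · refine (card_smallCuts_le_Gamma c hc k hk _ V ends rfl hle hmin).trans ?_
    gcongr
    exact Real.Gamma_div_Gamma_le_rpow (by linarith) (by linarith) (by linarith)
  · have h1 : ((smallCuts ends (k * c / 2)).card : ℝ) ≤ 2 ^ Fintype.card V := by
      exact_mod_cast card_smallCuts_le_two_pow ends (k * c / 2)
    have h2 : (2 : ℝ) ^ Fintype.card V ≤ (Fintype.card V : ℝ) ^ k :=
      calc (2 : ℝ) ^ Fintype.card V ≤ (Fintype.card V : ℝ) ^ Fintype.card V := by gcongr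
        _ = (Fintype.card V : ℝ) ^ (Fintype.card V : ℝ) := (Real.rpow_natCast _ _).symm
        _ ≤ (Fintype.card V : ℝ) ^ k := Real.rpow_le_rpow_of_exponent_le (by linarith) hlt.le
    have h3 : (0 : ℝ) ≤ (Fintype.card V : ℝ) ^ k := by positivity
    linarith

/-- The layer-cake bound: if at most `2 t` of the weights `w` are at most `t`, for every
`t ≥ M`, then the sum of `w ^ (-β)` is controlled. -/
lemma sum_rpow_neg_le_of_card_le {ι : Type} (S : Finset ι) (w : ι → ℝ) (M β : ℝ) (hM : 0 < M)
    (hβ : 1 < β) (hw : ∀ i ∈ S, M ≤ w i)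
    (hcount : ∀ t, M < t → ((S.filter (fun i => w i < t)).card : ℝ) ≤ 2 * t) :
    ∑ i ∈ S, w i ^ (-β) ≤ 2 * (β / (β - 1) * M ^ (1 - β)) := by
  have hint : MeasureTheory.IntegrableOn (fun t : ℝ => β * t ^ (-β - 1)) (Set.Ioi M) :=
    (integrableOn_Ioi_rpow_of_lt (by linarith) hM).const_mul β
  have hint' : MeasureTheory.IntegrableOn (fun t : ℝ => 2 * β * t ^ (-β)) (Set.Ioi M) :=
    (integrableOn_Ioi_rpow_of_lt (by linarith) hM).const_mul _
  have hterm : ∀ i ∈ S, w i ^ (-β)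
      = ∫ t in Set.Ioi M, (Set.Ioi (w i)).indicator (fun t : ℝ => β * t ^ (-β - 1)) t := by
    intro i hi
    have hwi : 0 < w i := hM.trans_le (hw i hi)
    rw [MeasureTheory.setIntegral_indicator measurableSet_Ioi,
      Set.inter_eq_right.mpr (Set.Ioi_subset_Ioi (hw i hi)), MeasureTheory.integral_const_mul,
      integral_Ioi_rpow_of_lt (by linarith) hwi]
    have : (-β - 1 + 1) = -β := by ring
    rw [this]
    have : β ≠ 0 := by linarith
    field_simp
  rw [Finset.sum_congr rfl hterm, ← MeasureTheory.integral_finsetSum _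
    (fun i _ => hint.indicator measurableSet_Ioi)]
  calc _ ≤ ∫ t in Set.Ioi M, 2 * β * t ^ (-β) := by
        refine MeasureTheory.setIntegral_mono_on
          (MeasureTheory.integrable_finsetSum _ fun i _ => hint.indicator measurableSet_Ioi)
          hint' measurableSet_Ioi fun t ht => ?_
        have ht' : M < t := ht
        have ht0 : 0 < t := hM.trans ht'
        have h1 : ∑ i ∈ S, (Set.Ioi (w i)).indicator (fun t : ℝ => β * t ^ (-β - 1)) t
            = (S.filter (fun i => w i < t)).card * (β * t ^ (-β - 1)) := by
          simp only [Set.indicator_apply, Set.mem_Ioi]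
          rw [← Finset.sum_filter]
          simp
        rw [h1]
        calc _ ≤ 2 * t * (β * t ^ (-β - 1)) := by
              gcongr
              exact hcount t ht'
          _ = 2 * β * t ^ (-β) := by
              rw [Real.rpow_sub_one ht0.ne']
              field_simp
    _ = 2 * (β / (β - 1) * M ^ (1 - β)) := by
        rw [MeasureTheory.integral_const_mul, integral_Ioi_rpow_of_lt (by linarith) hM,
          show -β + 1 = 1 - β by ring, show (1 - β) = -(β - 1) by ring]
        have : β - 1 ≠ 0 := by linarith
        field_simp

/-- The probability that all edges of `D` fail. -/
lemma failurePr_superset {E : Type} [Fintype E] (p : ℝ) (D : Finset E) :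
    failurePr p (Finset.univ.filter (fun F : Finset E => D ⊆ F)) = p ^ D.card := by
  have h := Finset.prod_add (fun _ : E => p) (fun e => if e ∈ D then 0 else 1 - p) Finset.univ
  have hl : ∏ e : E, (p + if e ∈ D then 0 else 1 - p) = p ^ D.card := by
    have : ∀ e : E, (p + if e ∈ D then 0 else 1 - p) = if e ∈ D then p else 1 := by
      intro e
      split_ifs <;> ring
    simp only [this]
    rw [Finset.prod_ite]
    simp
  rw [← hl, h, failurePr, Finset.sum_filter, Finset.powerset_univ]
  refine Finset.sum_congr rfl fun F _ => ?_
  split_ifs with hD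
  · rw [Finset.prod_const, Finset.prod_congr rfl (g := fun _ => 1 - p), Finset.prod_const,
      ← Finset.compl_eq_univ_sdiff, Finset.card_compl]
    intro e he
    exact if_neg fun h => (Finset.mem_sdiff.mp he).2 (hD h)
  · obtain ⟨e, heD, heF⟩ := Finset.not_subset.mp hD
    rw [Finset.prod_eq_zero (i := e) (s := Finset.univ \ F) (by simp [heF]) (by simp [heD]),
      mul_zero]

lemma exists_cutEdges_subset_of_not_connected {V E : Type} [Fintype V] [Nonempty V] [Fintype E]
    (ends : E → Sym2 V) (F : Finset E) (h : ¬ (survGraph ends F).Connected) :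
    ∃ A ∈ properSets V, cutEdges ends A ⊆ F := by
  have h' : ¬ (survGraph ends F).Preconnected := fun hp => h ⟨hp⟩
  unfold SimpleGraph.Preconnected at h'
  push Not at h'
  obtain ⟨x, y, hxy⟩ := h'
  refine ⟨Finset.univ.filter (fun v => (survGraph ends F).Reachable x v),
    mem_properSets.mpr ⟨⟨x, by simp⟩, y, by simpa using hxy⟩, ?_⟩
  intro e he
  by_contra heF
  obtain ⟨a, b, hab⟩ : ∃ a b, ends e = s(a, b) := by
    induction h' : ends e with | _ a b => exact ⟨a, b, rfl⟩
  simp only [cutEdges, Finset.mem_filter, Finset.mem_univ, true_and] at he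
  have hd := not_isDiag_of_crosses he
  rw [crosses_iff_of_ends_eq hab] at he
  rw [hab, Sym2.mk_isDiag_iff] at hd
  have hadj : (survGraph ends F).Adj a b := by
    rw [survGraph, SimpleGraph.fromRel_adj]
    exact ⟨hd, Or.inl ⟨e, heF, hab⟩⟩
  simp only [Finset.mem_filter, Finset.mem_univ, true_and] at he
  exact he ⟨fun h => h.trans hadj.reachable, fun h => h.trans hadj.symm.reachable⟩

lemma cutEdges_compl {V E : Type} [Fintype V] [Fintype E] (ends : E → Sym2 V) (A : Finset V) :
    cutEdges ends Aᶜ = cutEdges ends A := by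
  ext e
  simp [cutEdges, crosses, and_comm]

lemma two_mul_failurePr_not_connected_le {V E : Type} [Fintype V] [Nonempty V] [Fintype E]
    (ends : E → Sym2 V) (p : ℝ) (hp0 : 0 ≤ p) (hp1 : p ≤ 1) :
    2 * failurePr p (Finset.univ.filter (fun F : Finset E => ¬ (survGraph ends F).Connected))
      ≤ ∑ A ∈ properSets V, p ^ cutValue ends A := by
  have hq : 0 ≤ 1 - p := by linarith
  simp only [cutValue, ← failurePr_superset]
  simp only [failurePr, Finset.sum_filter]
  rw [Finset.sum_comm, Finset.mul_sum]
  refine Finset.sum_le_sum fun F _ => ?_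
  rw [← Finset.sum_filter, Finset.sum_const, nsmul_eq_mul]
  by_cases hF : (survGraph ends F).Connected
  · rw [if_neg (not_not.mpr hF), mul_zero]
    positivity
  · rw [if_pos hF]
    obtain ⟨A, hA, hAF⟩ := exists_cutEdges_subset_of_not_connected ends F hF
    have hA' := mem_properSets.mp hA
    have hne : A ≠ Aᶜ := by
      intro h
      obtain ⟨v, hv⟩ := hA'.1
      have hv' := hv
      rw [h] at hv'
      exact Finset.mem_compl.mp hv' hv
    have h2 : 2 ≤ ((properSets V).filter (fun A => cutEdges ends A ⊆ F)).card := by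
      rw [← Finset.card_pair hne]
      refine Finset.card_le_card ?_
      intro B hB
      rw [Finset.mem_insert, Finset.mem_singleton] at hB
      rcases hB with rfl | rfl
      · exact Finset.mem_filter.mpr ⟨hA, hAF⟩
      · refine Finset.mem_filter.mpr ⟨mem_properSets.mpr ?_, by rwa [cutEdges_compl]⟩
        obtain ⟨⟨v, hv⟩, z, hz⟩ := hA'
        exact ⟨⟨z, by simpa using hz⟩, v, by simpa using hv⟩
    gcongr
    exact_mod_cast h2

/-- If a multigraph on `n ≥ 2` vertices has minimum cut value `c ≥ 1` and each
edge fails independently with probability `p ∈ [0,1]` where `p ^ c = n ^ (-(2 + δ))` for some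
`δ > 0`, then the probability that the surviving graph is disconnected is at most
`n ^ (-δ) * (1 + 2 / δ)`. -/
theorem stmt1 {V E : Type} [Fintype V] [DecidableEq V] [Fintype E]
    (ends : E → Sym2 V) (hnd : ∀ e, ¬ (ends e).IsDiag)
    (hn : 2 ≤ Fintype.card V) (c : ℕ) (hc : 1 ≤ c)
    (hmin : ∀ A : Finset V, A.Nonempty → Aᶜ.Nonempty → c ≤ cutValue ends A)
    (hex : ∃ A : Finset V, A.Nonempty ∧ Aᶜ.Nonempty ∧ cutValue ends A = c)
    (p δ : ℝ) (hp0 : 0 ≤ p) (hp1 : p ≤ 1) (hδ : 0 < δ)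
    (hpc : p ^ c = (Fintype.card V : ℝ) ^ (-(2 + δ))) :
    failurePr p (Finset.univ.filter (fun F : Finset E => ¬ (survGraph ends F).Connected))
      ≤ (Fintype.card V : ℝ) ^ (-δ) * (1 + 2 / δ) := by
  have hV : Nonempty V := Fintype.card_pos_iff.mp (by omega)
  have hmin' : ∀ A ∈ properSets V, c ≤ cutValue ends A := by
    intro A hA
    obtain ⟨hA, v, hv⟩ := mem_properSets.mp hA
    exact hmin A hA ⟨v, by simpa using hv⟩
  set n : ℝ := (Fintype.card V : ℝ) with hndef
  have hn2 : (2 : ℝ) ≤ n := by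
    rw [hndef]
    exact_mod_cast hn
  have hn0 : 0 < n := by linarith
  have hc0 : (0 : ℝ) < c := by exact_mod_cast hc
  set β : ℝ := 1 + δ / 2 with hβ
  let w : Finset V → ℝ := fun A => n ^ (2 * cutValue ends A / c : ℝ)
  have hterm : ∀ A, p ^ cutValue ends A = w A ^ (-β) := by
    intro A
    have hpn : p = n ^ (-(2 + δ) / c) := by
      rw [div_eq_mul_inv, Real.rpow_mul hn0.le, ← hpc,
        Real.pow_rpow_inv_natCast hp0 (by omega)]
    rw [hpn, ← Real.rpow_natCast, ← Real.rpow_mul hn0.le, ← Real.rpow_mul hn0.le]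
    congr 1
    rw [hβ]
    field_simp
  have hsum := sum_rpow_neg_le_of_card_le (properSets V) w (n ^ (2 : ℝ)) β (by positivity)
    (by linarith) (by
      intro A hA
      refine Real.rpow_le_rpow_of_exponent_le (by linarith) ?_
      rw [le_div_iff₀ hc0]
      have : (c : ℝ) ≤ cutValue ends A := by exact_mod_cast hmin' A hA
      linarith) (by
      intro t ht
      have ht0 : 0 < t := lt_trans (by positivity) ht
      obtain ⟨k, rfl⟩ : ∃ k : ℝ, n ^ k = t :=
        ⟨Real.log t / Real.log n, Real.rpow_logb hn0 (by linarith) ht0⟩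
      have hk : 2 < k := (Real.rpow_lt_rpow_left_iff (by linarith)).mp ht
      refine le_trans ?_ (card_smallCuts_le ends hn c hc hmin' k hk.le)
      refine Nat.cast_le.mpr (Finset.card_le_card fun A hA => ?_)
      obtain ⟨hA, hlt⟩ := Finset.mem_filter.mp hA
      have := (Real.rpow_lt_rpow_left_iff (by linarith)).mp hlt
      rw [div_lt_iff₀ hc0] at this
      exact mem_smallCuts.mpr ⟨hA, by linarith⟩)
  have hunion := two_mul_failurePr_not_connected_le ends p hp0 hp1
  simp only [hterm] at hunion
  have hfin : β / (β - 1) * (n ^ (2 : ℝ)) ^ (1 - β) = n ^ (-δ) * (1 + 2 / δ) := by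
    rw [← Real.rpow_mul hn0.le, show 2 * (1 - β) = -δ by rw [hβ]; ring, mul_comm]
    have hβ1 : β - 1 = δ / 2 := by rw [hβ]; ring
    rw [hβ1, hβ]
    field_simp
    ring
  rw [hfin] at hsum
  refine le_of_eq_of_le ?_ (le_of_mul_le_mul_left (hunion.trans hsum) two_pos)
  congr!
end

section
/- Let G be a multigraph on n ≥ 2 vertices with minimum cut value c ≥ 1, and suppose each edge fails independently with probability p ∈ [0,1], where p^c = n^{-(2+δ)} for some real δ > 0. Then for every integer r ≥ 2, the probability that the surviving graph has r or more connected components is less than n^{-rδ/2}. -/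
open scoped Classical

/-- The vertex set of a connected component, as a finset. -/
noncomputable def componentFinset {V : Type} [Fintype V] {G : SimpleGraph V}
    (C : G.ConnectedComponent) : Finset V :=
  Finset.univ.filter (fun v => G.connectedComponentMk v = C)

/-- The edges joining two distinct connected components of the surviving graph. -/
noncomputable def joiningEdges {V E : Type} [Fintype V] [Fintype E] (ends : E → Sym2 V)
    (F : Finset E) : Finset E :=
  Finset.univ.filter (fun e => ∃ C : (survGraph ends F).ConnectedComponent,
    crosses ends (componentFinset C) e)

section Components

variable {V E : Type} (ends : E → Sym2 V)

lemma survGraph_anti {F F' : Finset E} (h : F' ⊆ F) : survGraph ends F ≤ survGraph ends F' := by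
  intro x y hxy
  simp only [survGraph, SimpleGraph.fromRel_adj] at hxy ⊢
  refine ⟨hxy.1, hxy.2.imp ?_ ?_⟩ <;>
  · rintro ⟨e, he, hxy⟩
    exact ⟨e, fun h' => he (h h'), hxy⟩

lemma connectedComponentMk_eq_of_notMem {F : Finset E} {e : E} (he : e ∉ F) {x y : V}
    (hxy : ends e = s(x, y)) :
    (survGraph ends F).connectedComponentMk x = (survGraph ends F).connectedComponentMk y := by
  by_cases h : x = y
  · rw [h]
  · refine SimpleGraph.ConnectedComponent.eq.2 (SimpleGraph.Adj.reachable ?_)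
    simp only [survGraph, SimpleGraph.fromRel_adj]
    exact ⟨h, Or.inl ⟨e, he, hxy⟩⟩

lemma componentMap_surjective {G G' : SimpleGraph V} (h : G ≤ G') :
    Function.Surjective
      (SimpleGraph.ConnectedComponent.map (SimpleGraph.Hom.ofLE h)) := by
  intro C
  induction C using SimpleGraph.ConnectedComponent.ind with
  | h v => exact ⟨G.connectedComponentMk v, rfl⟩

variable [Fintype V]

lemma mem_componentFinset {G : SimpleGraph V} (C : G.ConnectedComponent) (v : V) :
    v ∈ componentFinset C ↔ G.connectedComponentMk v = C := by
  simp [componentFinset]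

lemma numComponents_anti {F F' : Finset E} (h : F' ⊆ F) :
    numComponents ends F' ≤ numComponents ends F :=
  Nat.card_le_card_of_surjective _ (componentMap_surjective (survGraph_anti ends h))

lemma numComponents_le_card (F : Finset E) : numComponents ends F ≤ Fintype.card V := by
  rw [← Nat.card_eq_fintype_card]
  refine Nat.card_le_card_of_surjective (survGraph ends F).connectedComponentMk ?_
  intro C
  exact C.exists_rep

/-- Two ends of an edge that crosses a component lie in distinct components. -/
lemma connectedComponentMk_ne_of_crosses {G : SimpleGraph V} {C : G.ConnectedComponent} {e : E}
    (h : crosses ends (componentFinset C) e) {x y : V} (hxy : ends e = s(x, y)) :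
    G.connectedComponentMk x ≠ G.connectedComponentMk y := by
  obtain ⟨⟨a, ha, haC⟩, b, hb, hbC⟩ := h
  rw [mem_componentFinset] at haC hbC
  rw [hxy, Sym2.mem_iff] at ha hb
  intro hxy
  rcases ha with rfl | rfl <;> rcases hb with rfl | rfl <;> simp_all

variable [Fintype E]

lemma joiningEdges_subset (F : Finset E) : joiningEdges ends F ⊆ F := by
  intro e he
  simp only [joiningEdges, Finset.mem_filter, Finset.mem_univ, true_and] at he
  obtain ⟨C, hC⟩ := he
  by_contra heF
  obtain ⟨x, y, hxy⟩ : ∃ x y, ends e = s(x, y) := by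
    induction h : ends e with
    | _ x y => exact ⟨x, y, rfl⟩
  exact connectedComponentMk_ne_of_crosses ends hC hxy
    (connectedComponentMk_eq_of_notMem ends heF hxy)

lemma numComponents_erase_lt {F : Finset E} {e : E} (he : e ∈ joiningEdges ends F) :
    numComponents ends (F.erase e) < numComponents ends F := by
  simp only [joiningEdges, Finset.mem_filter, Finset.mem_univ, true_and] at he
  obtain ⟨C, hC⟩ := he
  obtain ⟨x, y, hxy⟩ : ∃ x y, ends e = s(x, y) := by
    induction h : ends e with
    | _ x y => exact ⟨x, y, rfl⟩
  have hle := survGraph_anti ends (F.erase_subset e)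
  refine lt_of_le_of_ne (numComponents_anti ends (F.erase_subset e)) fun hcard => ?_
  have hbij := (Function.Surjective.bijective_of_nat_card_le
    (componentMap_surjective hle) hcard.ge)
  refine connectedComponentMk_ne_of_crosses ends hC hxy (hbij.injective ?_)
  exact connectedComponentMk_eq_of_notMem ends (F.notMem_erase e) hxy

/-- If every cut has value at least `c`, then `k ≥ 2` components are joined by at least
`c * k / 2` edges. -/
lemma mul_numComponents_le (c : ℕ)
    (hmin : ∀ A : Finset V, A.Nonempty → (∃ v, v ∉ A) → c ≤ cutValue ends A)
    (F : Finset E) (hF : 2 ≤ numComponents ends F) :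
    c * numComponents ends F ≤ 2 * (joiningEdges ends F).card := by
  set G := survGraph ends F with hG
  have hnontriv : Nontrivial G.ConnectedComponent := Finite.one_lt_card_iff_nontrivial.1 hF
  have hcut (C : G.ConnectedComponent) : c ≤ cutValue ends (componentFinset C) := by
    refine hmin _ ?_ ?_
    · obtain ⟨v, hv⟩ := C.exists_rep
      exact ⟨v, (mem_componentFinset C v).2 hv⟩
    · obtain ⟨D, hD⟩ := exists_ne C
      obtain ⟨v, hv⟩ := D.exists_rep
      exact ⟨v, fun h => hD (hv.symm.trans ((mem_componentFinset C v).1 h))⟩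
  have hdouble := Finset.sum_card_bipartiteAbove_eq_sum_card_bipartiteBelow
    (s := (Finset.univ : Finset G.ConnectedComponent)) (t := joiningEdges ends F)
    (fun C e => crosses ends (componentFinset C) e)
  have hlow : c * numComponents ends F ≤ ∑ C : G.ConnectedComponent,
      ((joiningEdges ends F).bipartiteAbove
        (fun C e => crosses ends (componentFinset C) e) C).card := by
    rw [numComponents, Nat.card_eq_fintype_card, mul_comm, ← smul_eq_mul, ← Finset.card_univ]
    refine Finset.card_nsmul_le_sum _ _ _ fun C _ => (hcut C).trans ?_
    refine Finset.card_le_card fun e he => ?_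
    simp only [cutEdges, Finset.mem_filter, Finset.mem_univ, true_and] at he
    simp only [Finset.bipartiteAbove, Finset.mem_filter, joiningEdges, Finset.mem_univ, true_and]
    exact ⟨⟨C, he⟩, he⟩
  have hup : ∑ e ∈ joiningEdges ends F, ((Finset.univ : Finset G.ConnectedComponent).bipartiteBelow
        (fun C e => crosses ends (componentFinset C) e) e).card
      ≤ (joiningEdges ends F).card • 2 := by
    refine Finset.sum_le_card_nsmul _ _ _ fun e _ => ?_
    obtain ⟨x, y, hxy⟩ : ∃ x y, ends e = s(x, y) := by
      induction h : ends e with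
      | _ x y => exact ⟨x, y, rfl⟩
    refine (Finset.card_le_card (t := {G.connectedComponentMk x, G.connectedComponentMk y})
      fun C hC => ?_).trans Finset.card_le_two
    simp only [Finset.bipartiteBelow, Finset.mem_filter, Finset.mem_univ, true_and] at hC
    obtain ⟨⟨a, ha, haC⟩, -⟩ := hC
    rw [mem_componentFinset] at haC
    rw [hxy, Sym2.mem_iff] at ha
    rcases ha with rfl | rfl <;> simp [haC]
  rw [smul_eq_mul] at hup
  linarith

/-- Restoring the failed edges one at a time decreases the number of `r`-sets of components by at
least `c * r / 2` times its value, in total. -/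
lemma choose_numComponents_le_sum_sub (c : ℕ)
    (hmin : ∀ A : Finset V, A.Nonempty → (∃ v, v ∉ A) → c ≤ cutValue ends A)
    (r : ℕ) (hr : 2 ≤ r) (F : Finset E) :
    (c * r / 2 : ℝ) * ((numComponents ends F).choose r : ℝ) ≤
      ∑ e ∈ F, (((numComponents ends F).choose r : ℝ)
        - ((numComponents ends (F.erase e)).choose r : ℝ)) := by
  have hnonneg (e : E) : (0 : ℝ) ≤ ((numComponents ends F).choose r : ℝ)
      - ((numComponents ends (F.erase e)).choose r : ℝ) := by
    rw [sub_nonneg]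
    exact_mod_cast Nat.choose_le_choose r (numComponents_anti ends (F.erase_subset e))
  rcases lt_or_ge (numComponents ends F) 2 with hF | hF
  · rw [Nat.choose_eq_zero_of_lt (hF.trans_le hr)] at hnonneg ⊢
    simpa using Finset.sum_nonneg fun e (_ : e ∈ F) => hnonneg e
  obtain ⟨k, hk⟩ : ∃ k, numComponents ends F = k + 1 := ⟨numComponents ends F - 1, by omega⟩
  obtain ⟨s, rfl⟩ : ∃ s, r = s + 1 := ⟨r - 1, by omega⟩
  have hterm (e : E) (he : e ∈ joiningEdges ends F) : (k.choose s : ℝ) ≤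
      ((numComponents ends F).choose (s + 1) : ℝ)
        - ((numComponents ends (F.erase e)).choose (s + 1) : ℝ) := by
    have hle : numComponents ends (F.erase e) ≤ k := by
      have := numComponents_erase_lt ends he
      omega
    have hch : ((numComponents ends (F.erase e)).choose (s + 1) : ℝ) ≤ k.choose (s + 1) := by
      exact_mod_cast Nat.choose_le_choose (s + 1) hle
    rw [hk, Nat.choose_succ_succ]
    push_cast
    linarith
  have hmul : ((k + 1 : ℕ) : ℝ) * (k.choose s : ℝ)
      = ((k + 1).choose (s + 1) : ℝ) * ((s + 1 : ℕ) : ℝ) := by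
    exact_mod_cast Nat.add_one_mul_choose_eq k s
  have hjoin : (c : ℝ) * ((k + 1 : ℕ) : ℝ) ≤ 2 * ((joiningEdges ends F).card : ℝ) := by
    have := mul_numComponents_le ends c hmin F hF
    rw [hk] at this
    exact_mod_cast this
  calc (c * (s + 1 : ℕ) / 2 : ℝ) * ((numComponents ends F).choose (s + 1) : ℝ)
      = (c : ℝ) * ((k + 1 : ℕ) : ℝ) / 2 * (k.choose s : ℝ) := by
        rw [hk]
        linear_combination (-(c : ℝ) / 2) * hmul
    _ ≤ (joiningEdges ends F).card * (k.choose s : ℝ) := by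
        refine mul_le_mul_of_nonneg_right ?_ (Nat.cast_nonneg _)
        linarith
    _ ≤ ∑ e ∈ joiningEdges ends F, (((numComponents ends F).choose (s + 1) : ℝ)
        - ((numComponents ends (F.erase e)).choose (s + 1) : ℝ)) := by
        rw [← nsmul_eq_mul]
        exact Finset.card_nsmul_le_sum _ _ _ hterm
    _ ≤ _ := Finset.sum_le_sum_of_subset_of_nonneg (joiningEdges_subset ends F)
        fun e _ _ => hnonneg e

end Components

section Expectation

variable {E : Type} [Fintype E]

/-- The expectation of `g` at the random set of failed edges, when each edge fails independently
with probability `p`. -/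
noncomputable def failureExp (g : Finset E → ℝ) (p : ℝ) : ℝ :=
  ∑ F : Finset E, p ^ F.card * (1 - p) ^ (Fintype.card E - F.card) * g F

lemma failureExp_one (g : Finset E → ℝ) : failureExp g 1 = g Finset.univ := by
  rw [failureExp, Finset.sum_eq_single Finset.univ]
  · simp
  · intro F _ hF
    have : F.card < Fintype.card E := (Finset.card_lt_iff_ne_univ F).2 hF
    rw [sub_self, zero_pow (by omega)]
    simp
  · simp

/-- Russo's formula for the expectation of a function of the failed edges. -/
lemma hasDerivAt_failureExp (g : Finset E → ℝ) (p : ℝ) :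
    HasDerivAt (failureExp g)
      (∑ F : Finset E, ∑ e ∈ F, p ^ (F.card - 1) * (1 - p) ^ (Fintype.card E - F.card)
        * (g F - g (F.erase e))) p := by
  have hderiv : HasDerivAt (failureExp g)
      (∑ F : Finset E, ((F.card : ℝ) * p ^ (F.card - 1) * (1 - p) ^ (Fintype.card E - F.card)
        + p ^ F.card * (((Fintype.card E - F.card : ℕ) : ℝ)
          * (1 - p) ^ (Fintype.card E - F.card - 1) * (-1))) * g F) p := by
    unfold failureExp
    refine HasDerivAt.fun_sum fun F _ => HasDerivAt.mul_const ?_ _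
    refine (hasDerivAt_pow _ p).mul ?_
    exact ((hasDerivAt_id p).const_sub 1).pow _
  convert hderiv using 1
  have hswap : ∑ F : Finset E, ∑ e ∈ F,
        p ^ (F.card - 1) * (1 - p) ^ (Fintype.card E - F.card) * g (F.erase e)
      = ∑ F : Finset E, ∑ e ∈ Fᶜ,
        p ^ F.card * (1 - p) ^ (Fintype.card E - F.card - 1) * g F := by
    rw [Finset.sum_sigma', Finset.sum_sigma']
    refine Finset.sum_bij' (fun x _ => ⟨x.1.erase x.2, x.2⟩) (fun x _ => ⟨insert x.2 x.1, x.2⟩)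
      ?_ ?_ ?_ ?_ ?_
    · simp
    · simp
    · rintro ⟨F, e⟩ h
      simp only [Finset.mem_sigma, Finset.mem_univ, true_and] at h
      simp [Finset.insert_erase h]
    · rintro ⟨F, e⟩ h
      simp only [Finset.mem_sigma, Finset.mem_univ, true_and, Finset.mem_compl] at h
      simp [Finset.erase_insert h]
    · rintro ⟨F, e⟩ h
      simp only [Finset.mem_sigma, Finset.mem_univ, true_and] at h
      have hpos := Finset.card_pos.2 ⟨e, h⟩
      simp only [Finset.card_erase_of_mem h]
      congr 3
      omega
  simp only [mul_sub, Finset.sum_sub_distrib]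
  rw [hswap, ← Finset.sum_sub_distrib]
  refine Finset.sum_congr rfl fun F _ => ?_
  simp only [Finset.sum_const, nsmul_eq_mul, Finset.card_compl]
  ring

/-- If restoring failed edges decreases `g` by at least `s * g` in total, then the expectation of
`g` is at most `p ^ s` times its value when all edges fail. -/
lemma failureExp_le_rpow_mul (g : Finset E → ℝ) (s : ℝ)
    (hg : ∀ F, s * g F ≤ ∑ e ∈ F, (g F - g (F.erase e)))
    {p : ℝ} (hp0 : 0 < p) (hp1 : p ≤ 1) :
    failureExp g p ≤ p ^ s * g Finset.univ := by
  have hderiv (x : ℝ) (hx : 0 < x) := (hasDerivAt_failureExp g x).mul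
    (Real.hasDerivAt_rpow_const (p := -s) (Or.inl hx.ne'))
  have hmono : MonotoneOn (failureExp g * fun x : ℝ => x ^ (-s)) (Set.Icc p 1) := by
    refine monotoneOn_of_deriv_nonneg (convex_Icc p 1) ?_ ?_ ?_
    · exact fun x hx => (hderiv x (hp0.trans_le hx.1)).continuousAt.continuousWithinAt
    · intro x hx
      rw [interior_Icc] at hx
      exact (hderiv x (hp0.trans hx.1)).differentiableAt.differentiableWithinAt
    · intro x hx
      rw [interior_Icc] at hx
      have hx0 : 0 < x := hp0.trans hx.1
      rw [(hderiv x hx0).deriv, Real.rpow_sub_one hx0.ne']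
      have hkey : s * failureExp g x ≤ x * ∑ F : Finset E, ∑ e ∈ F, x ^ (F.card - 1)
          * (1 - x) ^ (Fintype.card E - F.card) * (g F - g (F.erase e)) := by
        rw [failureExp, Finset.mul_sum, Finset.mul_sum]
        refine Finset.sum_le_sum fun F _ => ?_
        have hw : 0 ≤ x ^ F.card * (1 - x) ^ (Fintype.card E - F.card) :=
          mul_nonneg (pow_nonneg hx0.le _) (pow_nonneg (by linarith [hx.2]) _)
        calc s * (x ^ F.card * (1 - x) ^ (Fintype.card E - F.card) * g F)
            = x ^ F.card * (1 - x) ^ (Fintype.card E - F.card) * (s * g F) := by ring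
          _ ≤ x ^ F.card * (1 - x) ^ (Fintype.card E - F.card)
              * ∑ e ∈ F, (g F - g (F.erase e)) := mul_le_mul_of_nonneg_left (hg F) hw
          _ = _ := by
            rw [Finset.mul_sum, Finset.mul_sum]
            refine Finset.sum_congr rfl fun e he => ?_
            rw [← mul_pow_sub_one (Finset.card_pos.2 ⟨e, he⟩).ne' x]
            ring
      set D := ∑ F : Finset E, ∑ e ∈ F, x ^ (F.card - 1)
          * (1 - x) ^ (Fintype.card E - F.card) * (g F - g (F.erase e))
      have hfac : D * x ^ (-s) + failureExp g x * (-s * (x ^ (-s) / x))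
          = x ^ (-s) / x * (x * D - s * failureExp g x) := by
        field_simp
        ring
      rw [hfac]
      exact mul_nonneg (div_nonneg (Real.rpow_nonneg hx0.le _) hx0.le) (sub_nonneg.2 hkey)
  have hle := hmono ⟨le_rfl, hp1⟩ ⟨hp1, le_rfl⟩ hp1
  simp only [Pi.mul_apply, failureExp_one, Real.one_rpow, mul_one] at hle
  rw [Real.rpow_neg hp0.le, ← div_eq_mul_inv, div_le_iff₀ (Real.rpow_pos_of_pos hp0 s)] at hle
  linarith

/-- Markov's inequality for the number of `r`-sets. -/
lemma failurePr_le_failureExp_choose (N : Finset E → ℕ) (r : ℕ) {p : ℝ} (hp0 : 0 ≤ p)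
    (hp1 : p ≤ 1) :
    failurePr p (Finset.univ.filter (fun F : Finset E => r ≤ N F))
      ≤ failureExp (fun F => ((N F).choose r : ℝ)) p := by
  have hw (F : Finset E) : 0 ≤ p ^ F.card * (1 - p) ^ (Fintype.card E - F.card) :=
    mul_nonneg (pow_nonneg hp0 _) (pow_nonneg (by linarith) _)
  rw [failurePr, failureExp, Finset.sum_filter]
  refine Finset.sum_le_sum fun F _ => ?_
  split_ifs with h
  · refine le_mul_of_one_le_right (hw F) ?_
    exact_mod_cast Nat.choose_pos h
  · exact mul_nonneg (hw F) (Nat.cast_nonneg _)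

end Expectation

/-- Let `G` be a multigraph on `n ≥ 2` vertices with minimum cut value `c ≥ 1`
whose edges fail independently with probability `p ∈ [0,1]`, where `p ^ c = n ^ (-(2+δ))` for
some `δ > 0`.  Then for every integer `r ≥ 2` the probability that the surviving graph has `r`
or more connected components is less than `n ^ (-r δ / 2)`. -/
theorem stmt13 {V E : Type} [Fintype V] [DecidableEq V] [Fintype E]
    (ends : E → Sym2 V) (hnd : ∀ e, ¬ (ends e).IsDiag)
    (hn : 2 ≤ Fintype.card V) (c : ℕ) (hc : 1 ≤ c)
    (hmin : ∀ A : Finset V, A.Nonempty → Aᶜ.Nonempty → c ≤ cutValue ends A)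
    (hex : ∃ A : Finset V, A.Nonempty ∧ Aᶜ.Nonempty ∧ cutValue ends A = c)
    (p δ : ℝ) (hp0 : 0 ≤ p) (hp1 : p ≤ 1) (hδ : 0 < δ)
    (hpc : p ^ c = (Fintype.card V : ℝ) ^ (-(2 + δ)))
    (r : ℕ) (hr2 : 2 ≤ r) :
    failurePr p (Finset.univ.filter (fun F : Finset E => r ≤ numComponents ends F))
      < (Fintype.card V : ℝ) ^ (-((r : ℝ) * δ / 2)) := by
  have hn0 : (0 : ℝ) < Fintype.card V := by exact_mod_cast (by omega : 0 < Fintype.card V)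
  have hp : 0 < p := by
    refine hp0.lt_of_ne' fun h => ?_
    rw [h, zero_pow (by omega)] at hpc
    exact (Real.rpow_pos_of_pos hn0 _).ne hpc
  have hmin' (A : Finset V) (hA : A.Nonempty) (hA' : ∃ v, v ∉ A) : c ≤ cutValue ends A := by
    obtain ⟨v, hv⟩ := hA'
    exact hmin A hA ⟨v, Finset.mem_compl.2 hv⟩
  have hexp := failureExp_le_rpow_mul (fun F => ((numComponents ends F).choose r : ℝ)) _
    (choose_numComponents_le_sum_sub ends c hmin' r hr2) hp hp1
  have hchoose : ((numComponents ends (Finset.univ : Finset E)).choose r : ℝ)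
      < (Fintype.card V : ℝ) ^ r := by
    exact_mod_cast (Nat.choose_le_choose r (numComponents_le_card ends _)).trans_lt
      (Nat.choose_lt_pow (by omega) hr2)
  have hpow : p ^ (c * r / 2 : ℝ) = (Fintype.card V : ℝ) ^ (-((r : ℝ) * δ / 2))
      / (Fintype.card V : ℝ) ^ r := by
    rw [mul_div_assoc, Real.rpow_mul hp0, Real.rpow_natCast, hpc, ← Real.rpow_mul hn0.le,
      ← Real.rpow_natCast _ r, ← Real.rpow_sub hn0]
    congr 1
    ring
  refine (failurePr_le_failureExp_choose _ r hp0 hp1).trans_lt (hexp.trans_lt ?_)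
  rw [hpow, div_mul_eq_mul_div, div_lt_iff₀ (pow_pos hn0 r)]
  exact mul_lt_mul_of_pos_left hchoose (Real.rpow_pos_of_pos hn0 _)
end
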